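/- arXiv:1906.09073 — 5 statements merged into one kernel-verified Lean document; each statement's English description precedes it below -/
import Mathlib

section
/- Let G be a dynamic graph over a finite nonempty set V, with a self-loop at every node in every round. Then Ker(G) = CRoots(Ḡ(∞)) = Roots(G(∞)): a node u belongs to the kernel of G if and only if u is a central root of the limit superior of the integral Ḡ, if and only if u is a root of the limit superior G(∞). -/
open scoped Classical

section DynamicGraphs

variable {V : Type*}

/-- The product digraph `G(t:t')`: edge `(u,v)` iff there is a path
`w_t = u, …, w_{t'+1} = v` with `(w_k, w_{k+1})` an edge of `G(k)` for `t ≤ k ≤ t'`.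
For `t' < t` it is the digraph with exactly a self-loop at each node. -/
def DProd (G : ℕ → V → V → Prop) (t t' : ℕ) (u v : V) : Prop :=
  if t' < t then u = v
  else ∃ w : ℕ → V, w t = u ∧ w (t' + 1) = v ∧ ∀ k, t ≤ k → k ≤ t' → G k (w k) (w (k + 1))

/-- The integral `Ḡ`: `(u,v)` is an edge of `Ḡ(t)` iff it is an edge of `G(t:t')`
for some `t' ≥ t`. -/
def Integral (G : ℕ → V → V → Prop) (t : ℕ) (u v : V) : Prop :=
  ∃ t', t ≤ t' ∧ DProd G t t' u v

/-- The limit superior of a dynamic graph: edges occurring at infinitely many rounds. -/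
def LimSupG (H : ℕ → V → V → Prop) (u v : V) : Prop :=
  ∀ t : ℕ, ∃ t', t ≤ t' ∧ H t' u v

/-- `u` is a central root of the digraph `H`: `(u,v)` is an edge for every `v`. -/
def IsCRoot (H : V → V → Prop) (u : V) : Prop := ∀ v, H u v

/-- `u` is a root of the digraph `H`: every node is reachable from `u` by a path. -/
def IsRoot (H : V → V → Prop) (u : V) : Prop := ∀ v, Relation.ReflTransGen H u v

/-- The kernel of a dynamic graph: `Ker(G) = ∩_{t ≥ 1} CRoots(Ḡ(t))`. -/
def Ker (G : ℕ → V → V → Prop) : Set V :=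
  {u | ∀ t, 1 ≤ t → IsCRoot (Integral G t) u}

/-- `G` is rooted with delay `T`: for every `t ≥ 1` the digraph `G(t : t+T-1)` is rooted. -/
def RootedWithDelay (G : ℕ → V → V → Prop) (T : ℕ) : Prop :=
  ∀ t, 1 ≤ t → ∃ u, IsRoot (fun a b => DProd G t (t + T - 1) a b) u

/-- The active graph `G^a` for start rounds `s`: `(u,v)` is an edge iff `u = v`, or
`(u,v)` is an edge of `G(t)` and both `u` and `v` are active in round `t`. -/
def Ga (G : ℕ → V → V → Prop) (s : V → ℕ) (t : ℕ) (u v : V) : Prop :=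
  u = v ∨ (G t u v ∧ s u ≤ t ∧ s v ≤ t)

lemma dprod_refl (H : ℕ → V → V → Prop) (hH : ∀ t u, H t u u) (t t' : ℕ) (u : V) :
    DProd H t t' u u := by
  unfold DProd
  split
  · rfl
  · exact ⟨fun _ => u, rfl, rfl, fun k _ _ => hH k u⟩

lemma ga_refl (G : ℕ → V → V → Prop) (s : V → ℕ) : ∀ (t : ℕ) (u : V), Ga G s t u u :=
  fun _ u => Or.inl rfl

end DynamicGraphs

section IntegralLemmas

variable {V : Type*} {G : ℕ → V → V → Prop}

/-- An edge of the integral is a journey of positive length. -/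
lemma integral_iff_exists_journey {t : ℕ} {u v : V} :
    Integral G t u v ↔ ∃ t', t ≤ t' ∧ ∃ w : ℕ → V, w t = u ∧ w (t' + 1) = v ∧
      ∀ k, t ≤ k → k ≤ t' → G k (w k) (w (k + 1)) := by
  refine exists_congr fun t' => and_congr_right fun h => ?_
  rw [DProd, if_neg (not_lt.2 h)]

lemma integral_refl (hloop : ∀ t u, G t u u) (t : ℕ) (u : V) : Integral G t u u :=
  ⟨t, le_rfl, dprod_refl G hloop t t u⟩

lemma integral_antitone (hloop : ∀ t u, G t u u) {s t : ℕ} (hst : s ≤ t) {u v : V}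
    (h : Integral G t u v) : Integral G s u v := by
  obtain ⟨t', ht, w, hu, hv, hw⟩ := integral_iff_exists_journey.1 h
  refine integral_iff_exists_journey.2
    ⟨t', hst.trans ht, fun k => if k ≤ t then u else w k, if_pos hst, ?_, fun k _ hk => ?_⟩
  · simpa only [if_neg (show ¬ t' + 1 ≤ t by lia)] using hv
  · rcases lt_or_ge k t with hkt | hkt
    · simpa only [if_pos hkt.le, if_pos (Nat.succ_le_of_lt hkt)] using hloop k u
    · have hwk : (if k ≤ t then u else w k) = w k := by
        split_ifs with hle
        · rw [← hu, le_antisymm hle hkt]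
        · rfl
      simpa only [hwk, if_neg (show ¬ k + 1 ≤ t by lia)] using hw k hkt hk

/-- A journey can be extended by an edge that occurs infinitely often. -/
lemma integral_trans_limSupG (hloop : ∀ t u, G t u u) {t : ℕ} {u v x : V}
    (h : Integral G t u v) (hvx : LimSupG G v x) : Integral G t u x := by
  obtain ⟨s, hts, w, hu, hv, hw⟩ := integral_iff_exists_journey.1 h
  obtain ⟨r, hsr, hr⟩ := hvx (s + 1)
  refine integral_iff_exists_journey.2
    ⟨r, by lia, fun k => if k ≤ s then w k else if k ≤ r then v else x, ?_, ?_, fun k hk hkr => ?_⟩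
  · simpa only [if_pos hts] using hu
  · simp only [if_neg (show ¬ r + 1 ≤ s by lia), if_neg (show ¬ r + 1 ≤ r by lia)]
  · rcases lt_trichotomy k s with hks | rfl | hks
    · simpa only [if_pos hks.le, if_pos (Nat.succ_le_of_lt hks)] using hw k hk hks.le
    · simpa only [le_refl, if_true, if_neg (show ¬ k + 1 ≤ k by lia), if_pos hsr, hv]
        using hw k hk le_rfl
    · simp only [if_neg (show ¬ k ≤ s by lia), if_neg (show ¬ k + 1 ≤ s by lia), if_pos hkr]
      rcases hkr.lt_or_eq with hlt | rfl
      · simpa only [if_pos (Nat.succ_le_of_lt hlt)] using hloop k v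
      · simpa only [if_neg (show ¬ k + 1 ≤ k by lia)] using hr

/-- On a finite vertex set, from some round on all edges occur infinitely often. -/
lemma exists_forall_ge_limSupG [Finite V] (G : ℕ → V → V → Prop) :
    ∃ T, ∀ t, T ≤ t → ∀ u v, G t u v → LimSupG G u v := by
  rw [← Filter.eventually_atTop]
  refine Filter.eventually_all.2 fun u => Filter.eventually_all.2 fun v => ?_
  by_cases h : LimSupG G u v
  · exact Filter.Eventually.of_forall fun _ _ => h
  · simp only [LimSupG, not_forall, not_exists, not_and] at h
    obtain ⟨T, hT⟩ := h
    exact Filter.eventually_atTop.2 ⟨T, fun t ht he => absurd he (hT t ht)⟩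

lemma reflTransGen_of_integral {H : V → V → Prop} {t : ℕ} {u v : V}
    (hH : ∀ k, t ≤ k → ∀ a b, G k a b → H a b) (h : Integral G t u v) :
    Relation.ReflTransGen H u v := by
  obtain ⟨s, hts, w, rfl, rfl, hw⟩ := integral_iff_exists_journey.1 h
  have key : ∀ k, t ≤ k → k ≤ s + 1 → Relation.ReflTransGen H (w t) (w k) := by
    intro k hk
    induction k, hk using Nat.le_induction with
    | base => exact fun _ => .refl
    | succ k hk ih => exact fun hks => (ih (by lia)).tail (hH k hk _ _ (hw k hk (by lia)))
  exact key (s + 1) (by lia) le_rfl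

lemma mem_ker_iff (hloop : ∀ t u, G t u u) {u : V} :
    u ∈ Ker G ↔ ∀ t v, Integral G t u v :=
  ⟨fun h t v => integral_antitone hloop t.le_succ (h (t + 1) (by lia) v), fun h t _ => h t⟩

end IntegralLemmas

/-- `Ker(G) = CRoots(Ḡ(∞)) = Roots(G(∞))`. -/
theorem ker_eq_croots_limsup_integral_eq_roots_limsup {V : Type*} [Fintype V] [Nonempty V]
    (G : ℕ → V → V → Prop) (hloop : ∀ t u, G t u u) :
    ∀ u : V, (u ∈ Ker G ↔ IsCRoot (LimSupG (Integral G)) u) ∧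
      (u ∈ Ker G ↔ IsRoot (LimSupG G) u) := by
  intro u
  rw [mem_ker_iff hloop]
  refine ⟨⟨fun h v t => ⟨t, le_rfl, h t v⟩, fun h t v => ?_⟩, fun h v => ?_, fun h t v => ?_⟩
  · obtain ⟨s, hts, hs⟩ := h v t
    exact integral_antitone hloop hts hs
  · obtain ⟨T, hT⟩ := exists_forall_ge_limSupG G
    exact reflTransGen_of_integral hT (h T v)
  · induction h v with
    | refl => exact integral_refl hloop t u
    | tail _ hbc ih => exact integral_trans_limSupG hloop ih hbc
end

section
/- Let G be a dynamic graph over a finite nonempty set V of cardinality n, with a self-loop at every node in every round, and suppose G is rooted with delay T for some integer T ≥ 1. Then there exists a round s ≥ 1 such that for every t ≥ s and every node u ∈ V, the set In_u(t : t + T·(n − |Ker(G)|)) ∩ Ker(G) is nonempty, where |Ker(G)| is the cardinality of the kernel of G. -/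
open scoped Classical

section Reachability

variable {V : Type*} {G : ℕ → V → V → Prop}

/-- `v` is reachable from `u` along edges of the rounds `a, …, b - 1`. -/
def Reach (G : ℕ → V → V → Prop) (a b : ℕ) (u v : V) : Prop :=
  ∃ w : ℕ → V, w a = u ∧ w b = v ∧ ∀ k, a ≤ k → k < b → G k (w k) (w (k + 1))

lemma dprod_iff_reach {t t' : ℕ} (h : t ≤ t') (u v : V) :
    DProd G t t' u v ↔ Reach G t (t' + 1) u v := by
  simp only [DProd, Reach, if_neg (not_lt.mpr h), Nat.lt_succ_iff]

lemma Reach.refl (hloop : ∀ t u, G t u u) (a b : ℕ) (u : V) : Reach G a b u u :=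
  ⟨fun _ => u, rfl, rfl, fun k _ _ => hloop k u⟩

lemma Reach.trans {a b c : ℕ} {u v x : V} (hab : a ≤ b) (hbc : b ≤ c)
    (h₁ : Reach G a b u v) (h₂ : Reach G b c v x) : Reach G a c u x := by
  obtain ⟨w₁, h1a, h1b, h1⟩ := h₁
  obtain ⟨w₂, h2a, h2b, h2⟩ := h₂
  refine ⟨fun k => if k < b then w₁ k else w₂ k, ?_, ?_, ?_⟩
  · by_cases h : a < b
    · simp [h, h1a]
    · obtain rfl : a = b := by omega
      simp [h2a, ← h1a, h1b]
  · simp [not_lt.mpr hbc, h2b]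
  · intro k hak hkc
    rcases lt_trichotomy (k + 1) b with h | h | h
    · simpa [h, show k < b by omega] using h1 k hak (by omega)
    · have hk := h1 k hak (by omega)
      subst h
      simpa [h2a, ← h1b] using hk
    · simpa [show ¬ k < b by omega, show ¬ k + 1 < b by omega] using h2 k (by omega) hkc

lemma exists_edge_leaving {H : V → V → Prop} {A : Set V} {r v : V}
    (h : Relation.ReflTransGen H r v) (hr : r ∈ A) (hv : v ∉ A) :
    ∃ a ∈ A, ∃ b ∉ A, H a b := by
  induction h with
  | refl => exact absurd hr hv
  | @tail b c _ hbc ih =>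
    by_cases hb : b ∈ A
    · exact ⟨b, hb, c, hv, hbc⟩
    · exact ih hb

variable [Fintype V]

lemma mem_ker_of_frequently_isRoot (hloop : ∀ t u, G t u u) {T : ℕ} (hT : 1 ≤ T) {u : V}
    (hu : ∀ N, ∃ t, N ≤ t ∧ IsRoot (fun a b => DProd G t (t + T - 1) a b) u) :
    u ∈ Ker G := by
  intro t _
  have key : ∀ m ≤ Fintype.card V, ∃ t', t ≤ t' ∧ m ≤ {v | Reach G t t' u v}.ncard := by
    intro m
    induction m with
    | zero => exact fun _ => ⟨t, le_rfl, Nat.zero_le _⟩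
    | succ m ih =>
      intro hm
      obtain ⟨t', htt', hcard⟩ := ih (by omega)
      obtain ⟨p, hp, hroot⟩ := hu t'
      have hsub : {v | Reach G t t' u v} ⊆ {v | Reach G t p u v} := fun v hv =>
        Reach.trans htt' hp hv (Reach.refl hloop _ _ _)
      have hcard' := hcard.trans (Set.ncard_le_ncard hsub (Set.toFinite _))
      by_cases hall : ∀ v, Reach G t p u v
      · refine ⟨p, htt'.trans hp, ?_⟩
        simpa [hall, Set.ncard_univ] using hm
      · obtain ⟨v, hv⟩ := not_forall.mp hall
        obtain ⟨a, ha, b, hb, hab⟩ := exists_edge_leaving (A := {v | Reach G t p u v})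
          (hroot v) (Reach.refl hloop _ _ _) hv
        rw [dprod_iff_reach (by omega), show p + T - 1 + 1 = p + T by omega] at hab
        refine ⟨p + T, by omega, Nat.succ_le_of_lt (hcard'.trans_lt ?_)⟩
        refine Set.ncard_lt_ncard (Set.ssubset_iff_exists.mpr ⟨fun x hx => ?_, b, ?_, hb⟩)
          (Set.toFinite _)
        · exact Reach.trans (htt'.trans hp) (by omega) hx (Reach.refl hloop _ _ _)
        · exact Reach.trans (htt'.trans hp) (by omega) ha hab
  obtain ⟨t', htt', hcard⟩ := key _ le_rfl
  have huniv : {v | Reach G t t' u v} = Set.univ :=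
    Set.eq_of_subset_of_ncard_le (Set.subset_univ _)
      (by simpa [Set.ncard_univ] using hcard) (Set.toFinite _)
  intro v
  have hv : v ∈ {v | Reach G t t' u v} := huniv ▸ Set.mem_univ v
  exact ⟨t', htt', (dprod_iff_reach htt' u v).mpr
    (Reach.trans htt' (Nat.le_succ _) hv (Reach.refl hloop _ _ _))⟩

lemma exists_forall_ge_isRoot_mem_ker (hloop : ∀ t u, G t u u) {T : ℕ} (hT : 1 ≤ T) :
    ∃ s : ℕ, 1 ≤ s ∧ ∀ t, s ≤ t → ∀ u,
      IsRoot (fun a b => DProd G t (t + T - 1) a b) u → u ∈ Ker G := by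
  have h : ∀ u, ∃ N, ∀ t, N ≤ t →
      IsRoot (fun a b => DProd G t (t + T - 1) a b) u → u ∈ Ker G := by
    intro u
    by_contra! hcon
    obtain ⟨_, _, _, hnot⟩ := hcon 0
    refine hnot (mem_ker_of_frequently_isRoot hloop hT fun N => ?_)
    obtain ⟨t, ht, hroot, _⟩ := hcon N
    exact ⟨t, ht, hroot⟩
  choose N hN using h
  refine ⟨Finset.univ.sup N + 1, by omega, fun t ht u => hN u t ?_⟩
  have := Finset.le_sup (f := N) (Finset.mem_univ u)
  omega

lemma exists_reach_or_card_inneighbours (hloop : ∀ t u, G t u u) {T : ℕ} (hT : 1 ≤ T)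
    (hrooted : RootedWithDelay G T) {K : Set V} {s : ℕ} (hs : 1 ≤ s)
    (hK : ∀ t, s ≤ t → ∀ u, IsRoot (fun a b => DProd G t (t + T - 1) a b) u → u ∈ K)
    (u : V) (m t : ℕ) (ht : s ≤ t) :
    (∃ v ∈ K, Reach G t (t + T * m) v u) ∨ m + 1 ≤ {v | Reach G t (t + T * m) v u}.ncard := by
  induction m generalizing t with
  | zero =>
    right
    exact (Set.ncard_pos (Set.toFinite _)).mpr ⟨u, Reach.refl hloop _ _ _⟩
  | succ m ih =>
    have hend : t + T * (m + 1) = t + T + T * m := by ring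
    rw [hend]
    have hstep : t + T ≤ t + T + T * m := Nat.le_add_right _ _
    rcases ih (t + T) (by omega) with ⟨v, hv, hvu⟩ | hcard
    · exact Or.inl ⟨v, hv, Reach.trans (by omega) hstep (Reach.refl hloop _ _ _) hvu⟩
    · obtain ⟨r, hr⟩ := hrooted t (by omega)
      by_cases hru : Reach G (t + T) (t + T + T * m) r u
      · exact Or.inl ⟨r, hK t ht r hr,
          Reach.trans (by omega) hstep (Reach.refl hloop _ _ _) hru⟩
      · right
        obtain ⟨a, ha, b, hb, hab⟩ := exists_edge_leaving
          (A := {v | ¬ Reach G (t + T) (t + T + T * m) v u}) (hr u) hru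
          (not_not.mpr (Reach.refl hloop _ _ _))
        rw [dprod_iff_reach (by omega), show t + T - 1 + 1 = t + T by omega] at hab
        refine Nat.succ_le_of_lt (hcard.trans_lt ?_)
        refine Set.ncard_lt_ncard (Set.ssubset_iff_exists.mpr ⟨fun x hx => ?_, a, ?_, ha⟩)
          (Set.toFinite _)
        · exact Reach.trans (by omega) hstep (Reach.refl hloop _ _ _) hx
        · exact Reach.trans (by omega) hstep hab (not_not.mp hb)

end Reachability

/-- if `G` is rooted with delay `T`, then there is a round `s ≥ 1` such that
for all `t ≥ s` and every node `u`, `In_u(t : t + T·(n − |Ker(G)|)) ∩ Ker(G) ≠ ∅`. -/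
theorem kernel_in_bounded_inneighbourhood {V : Type*} [Fintype V] [Nonempty V]
    (G : ℕ → V → V → Prop) (hloop : ∀ t u, G t u u)
    (T : ℕ) (hT : 1 ≤ T) (hrooted : RootedWithDelay G T) :
    ∃ s : ℕ, 1 ≤ s ∧ ∀ t, s ≤ t → ∀ u : V,
      ∃ v ∈ Ker G, DProd G t (t + T * (Fintype.card V - (Ker G).ncard)) v u := by
  obtain ⟨s, hs, hroots⟩ := exists_forall_ge_isRoot_mem_ker hloop hT
  refine ⟨s, hs, fun t ht u => ?_⟩
  set m := Fintype.card V - (Ker G).ncard with hm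
  have hreach : ∃ v ∈ Ker G, Reach G t (t + T * m) v u := by
    rcases exists_reach_or_card_inneighbours hloop hT hrooted hs hroots u m t ht with h | hcard
    · exact h
    · by_contra! hdisj
      have hsub : {v | Reach G t (t + T * m) v u} ⊆ (Ker G)ᶜ :=
        fun v hv hker => hdisj v hker hv
      have hle := Set.ncard_le_ncard hsub (Set.toFinite _)
      have hadd := Set.ncard_add_ncard_compl (Ker G)
      rw [Nat.card_eq_fintype_card] at hadd
      omega
  obtain ⟨v, hv, hvu⟩ := hreach
  exact ⟨v, hv, (dprod_iff_reach (Nat.le_add_right _ _) v u).mpr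
    (Reach.trans (Nat.le_add_right _ _) (Nat.le_succ _) hvu (Reach.refl hloop _ _ _))⟩
end

section
/- Let G be a dynamic graph over a finite nonempty set V with a self-loop at every node in every round, with start rounds s_u, input values μ_u in a linearly ordered set 𝒱, cut-off values θ_u(t) with 0 ≤ θ_u(t) ≤ t, and MinMax outputs y_u(t). Assume the cut-offs are safe and that G is rooted with delay T for some integer T ≥ 1. Then there exists a round s' such that y_u(t) = m* for every node u and every t ≥ s'; moreover m* = μ_w for some node w. -/
open scoped Classical

section Values

variable {V 𝒱 : Type*} [Fintype V] [LinearOrder 𝒱]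

/-- `m_u(t) = min{μ_v : v ∈ In^a_u(1:t)}`. -/
noncomputable def mVal (G : ℕ → V → V → Prop) (s : V → ℕ) (μ : V → 𝒱) (u : V) (t : ℕ) : 𝒱 :=
  (Finset.univ.filter fun v => DProd (Ga G s) 1 t v u).inf'
    ⟨u, Finset.mem_filter.mpr ⟨Finset.mem_univ u, dprod_refl (Ga G s) (ga_refl G s) 1 t u⟩⟩ μ

/-- `m*_u = min{μ_v : v ∈ In^a_u(1:∞)}`. -/
noncomputable def mStar (G : ℕ → V → V → Prop) (s : V → ℕ) (μ : V → 𝒱) (u : V) : 𝒱 :=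
  (Finset.univ.filter fun v => ∃ t', 1 ≤ t' ∧ DProd (Ga G s) 1 t' v u).inf'
    ⟨u, Finset.mem_filter.mpr ⟨Finset.mem_univ u,
      ⟨1, le_refl 1, dprod_refl (Ga G s) (ga_refl G s) 1 1 u⟩⟩⟩ μ

/-- `m* = max{m*_u : u ∈ V}`. -/
noncomputable def mStarMax [Nonempty V] (G : ℕ → V → V → Prop) (s : V → ℕ) (μ : V → 𝒱) : 𝒱 :=
  Finset.univ.sup' Finset.univ_nonempty (mStar G s μ)

/-- The MinMax output `y_u(t) = max{ m_v(θ_u(t)) : v ∈ In^a_u(θ_u(t)+1 : t) }`. -/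
noncomputable def yVal (G : ℕ → V → V → Prop) (s : V → ℕ) (μ : V → 𝒱) (θ : V → ℕ → ℕ)
    (u : V) (t : ℕ) : 𝒱 :=
  (Finset.univ.filter fun v => DProd (Ga G s) (θ u t + 1) t v u).sup'
    ⟨u, Finset.mem_filter.mpr
      ⟨Finset.mem_univ u, dprod_refl (Ga G s) (ga_refl G s) (θ u t + 1) t u⟩⟩
    (fun v => mVal G s μ v (θ u t))

/-- The cut-offs are safe: `θ_u(t) → ∞` and `t - θ_u(t) → ∞`. -/
def SafeCutoffs (θ : V → ℕ → ℕ) : Prop :=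
  ∀ u : V, Filter.Tendsto (fun t => θ u t) Filter.atTop Filter.atTop ∧
    Filter.Tendsto (fun t => t - θ u t) Filter.atTop Filter.atTop

end Values

section Products

variable {V : Type*} {H : ℕ → V → V → Prop}

lemma DProd.trans {a b c : ℕ} {u v w : V} (huv : DProd H a b u v)
    (hvw : DProd H (b + 1) c v w) (hab : a ≤ b + 1) (hbc : b ≤ c) : DProd H a c u w := by
  rcases hbc.eq_or_lt with rfl | hbc
  · rw [DProd, if_pos (Nat.lt_succ_self b)] at hvw
    exact hvw ▸ huv
  rcases hab.eq_or_lt with rfl | hab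
  · rw [DProd, if_pos (Nat.lt_succ_self b)] at huv
    exact huv ▸ hvw
  rw [DProd, if_neg (by omega)] at huv hvw ⊢
  obtain ⟨p, rfl, hpv, hp⟩ := huv
  obtain ⟨q, hqv, rfl, hq⟩ := hvw
  refine ⟨fun k => if k ≤ b then p k else q k, if_pos (by omega), if_neg (by omega), ?_⟩
  intro k hak hkc
  rcases lt_trichotomy k b with h | rfl | h
  · simpa [h.le, Nat.succ_le_of_lt h] using hp k hak h.le
  · simpa [hqv, hpv] using hp k hak le_rfl
  · simpa [h.not_ge, show ¬ k + 1 ≤ b by omega] using hq k h hkc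

lemma DProd.mono_right (hH : ∀ t u, H t u u) {a b c : ℕ} {u v : V} (huv : DProd H a b u v)
    (hab : a ≤ b + 1) (hbc : b ≤ c) : DProd H a c u v :=
  huv.trans (dprod_refl H hH _ _ v) hab hbc

lemma dprod_congr {K : ℕ → V → V → Prop} {a b : ℕ} (h : ∀ k, a ≤ k → H k = K k) (u v : V) :
    DProd H a b u v ↔ DProd K a b u v := by
  unfold DProd
  split
  · rfl
  · refine exists_congr fun w => and_congr_right fun _ => and_congr_right fun _ => ?_
    exact forall_congr' fun k => forall_congr' fun hk => by rw [h k hk]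

lemma ga_eq_of_active {G : ℕ → V → V → Prop} (hloop : ∀ t u, G t u u) {s : V → ℕ} {t : ℕ}
    (ht : ∀ u, s u ≤ t) : Ga G s t = G t := by
  ext u v
  simp only [Ga, ht, and_true, or_iff_right_iff_imp]
  rintro rfl
  exact hloop t u

/-- A root whose out-neighborhood is not yet everything gains a new out-neighbor. -/
lemma exists_new_outNeighbor (hH : ∀ t u, H t u u) {a b c : ℕ} (hab : a ≤ b + 1) (hbc : b ≤ c)
    {r : V} (hr : IsRoot (DProd H (b + 1) c) r) (hnot : ¬ IsCRoot (DProd H a b) r) :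
    ∃ v, ¬ DProd H a b r v ∧ DProd H a c r v := by
  by_contra! hcon
  refine hnot fun v => ?_
  induction hr v with
  | refl => exact dprod_refl H hH a b r
  | tail _ hstep ih =>
    by_contra hn
    exact hcon _ hn (ih.trans hstep hab hbc)

/-- Products of sufficiently many rooted digraphs with self-loops have a central root. -/
lemma exists_isCRoot_of_rooted [Fintype V] (hH : ∀ t u, H t u u) {T t₀ : ℕ} (hT : 1 ≤ T)
    (hroot : ∀ t, t₀ ≤ t → ∃ r, IsRoot (DProd H t (t + T - 1)) r) :
    ∃ N, ∀ t, t₀ ≤ t → ∃ r, IsCRoot (DProd H t (t + N)) r := by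
  refine ⟨(Fintype.card V * Fintype.card V + 1) * T, fun t ht => ?_⟩
  let out : ℕ → V → Finset V := fun b r => Finset.univ.filter (DProd H t b r)
  have key : ∀ k, (∃ r, IsCRoot (DProd H t (t + k * T)) r) ∨
      k ≤ ∑ r, (out (t + k * T) r).card := by
    intro k
    induction k with
    | zero => exact Or.inr (Nat.zero_le _)
    | succ k ih =>
      have hle : t + k * T ≤ t + (k + 1) * T := by gcongr; omega
      by_cases hc : ∃ r, IsCRoot (DProd H t (t + k * T)) r
      · obtain ⟨r, hr⟩ := hc
        exact Or.inl ⟨r, fun v => (hr v).mono_right hH (by omega) hle⟩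
      right
      obtain ⟨r, hr⟩ := hroot (t + k * T + 1) (by omega)
      have he : t + k * T + 1 + T - 1 = t + (k + 1) * T := by rw [add_mul]; omega
      rw [he] at hr
      obtain ⟨v, hv, hv'⟩ := exists_new_outNeighbor hH (by omega) hle hr
        (fun h => hc ⟨r, h⟩)
      have hsub : ∀ x, out (t + k * T) x ⊆ out (t + (k + 1) * T) x := fun x y hy => by
        simp only [out, Finset.mem_filter, Finset.mem_univ, true_and] at hy ⊢
        exact hy.mono_right hH (by omega) hle
      have hlt : ∑ x, (out (t + k * T) x).card < ∑ x, (out (t + (k + 1) * T) x).card := by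
        refine Finset.sum_lt_sum (fun x _ => Finset.card_le_card (hsub x))
          ⟨r, Finset.mem_univ r, Finset.card_lt_card ((Finset.ssubset_iff_of_subset (hsub r)).2
            ⟨v, ?_, ?_⟩)⟩ <;> simpa [out]
      have := ih.resolve_left hc
      omega
  refine (key _).resolve_right fun h => ?_
  have hbound : ∀ b, ∑ x, (out b x).card ≤ Fintype.card V * Fintype.card V := fun b => by
    simpa using Finset.sum_le_card_nsmul Finset.univ (fun x => (out b x).card)
      (Fintype.card V) (fun x _ => Finset.card_le_univ _)
  exact absurd (h.trans (hbound _)) (by omega)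

end Products

section MinValues

variable {V 𝒱 : Type*} [Fintype V] [LinearOrder 𝒱]

lemma eventually_mVal_eq_mStar (G : ℕ → V → V → Prop) (s : V → ℕ) (μ : V → 𝒱) :
    ∀ᶠ t in Filter.atTop, ∀ v, mVal G s μ v t = mStar G s μ v := by
  rw [Filter.eventually_all]
  intro v
  have h : ∀ᶠ t in Filter.atTop, ∀ w, DProd (Ga G s) 1 t w v ↔
      ∃ t', 1 ≤ t' ∧ DProd (Ga G s) 1 t' w v := by
    rw [Filter.eventually_all]
    intro w
    by_cases hw : ∃ t', 1 ≤ t' ∧ DProd (Ga G s) 1 t' w v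
    · obtain ⟨t', ht', hd⟩ := hw
      filter_upwards [Filter.eventually_ge_atTop t'] with t ht
      exact iff_of_true (hd.mono_right (ga_refl G s) (by omega) ht) ⟨t', ht', hd⟩
    · filter_upwards [Filter.eventually_ge_atTop 1] with t ht
      exact iff_of_false (fun hd => hw ⟨t, ht, hd⟩) hw
  filter_upwards [h] with t ht
  unfold mVal mStar
  simp only [ht]

lemma mStar_le_of_frequently {G : ℕ → V → V → Prop} {s : V → ℕ} (μ : V → 𝒱) {u v : V}
    (h : ∃ᶠ t in Filter.atTop, ∃ t', t ≤ t' ∧ DProd (Ga G s) t t' v u) :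
    mStar G s μ u ≤ mStar G s μ v := by
  refine Finset.le_inf' _ _ fun w hw => ?_
  obtain ⟨-, t₁, ht₁, hwv⟩ := Finset.mem_filter.1 hw
  obtain ⟨t, ht, t', htt', hvu⟩ := Filter.frequently_atTop.1 h (t₁ + 1)
  refine Finset.inf'_le _ (Finset.mem_filter.2 ⟨Finset.mem_univ w, t', by omega, ?_⟩)
  obtain ⟨b, rfl⟩ : ∃ b, t = b + 1 := ⟨t - 1, by omega⟩
  exact (hwv.mono_right (ga_refl G s) (by omega) (by omega : t₁ ≤ b)).trans hvu
    (by omega) (by omega)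

end MinValues

/-- a safe MinMax algorithm on a dynamic graph rooted with delay `T`
stabilizes on `m*`, which is one of the input values. -/
theorem safe_minmax_stabilizes_bounded_delay {V 𝒱 : Type*} [Fintype V] [Nonempty V]
    [LinearOrder 𝒱]
    (G : ℕ → V → V → Prop) (hloop : ∀ t u, G t u u)
    (s : V → ℕ) (hs : ∀ u, 1 ≤ s u) (μ : V → 𝒱)
    (θ : V → ℕ → ℕ) (hθ : ∀ (u : V) (t : ℕ), 1 ≤ t → θ u t ≤ t)
    (hsafe : SafeCutoffs θ)
    (T : ℕ) (hT : 1 ≤ T) (hrooted : RootedWithDelay G T) :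
    (∃ s' : ℕ, ∀ (u : V) (t : ℕ), s' ≤ t → yVal G s μ θ u t = mStarMax G s μ) ∧
      ∃ w : V, mStarMax G s μ = μ w := by
  have hactive : ∀ t, Finset.univ.sup s + 1 ≤ t → Ga G s t = G t := fun t ht =>
    ga_eq_of_active hloop fun u => (Finset.le_sup (Finset.mem_univ u)).trans (by omega)
  obtain ⟨N, hN⟩ : ∃ N, ∀ t, Finset.univ.sup s + 1 ≤ t →
      ∃ r, IsCRoot (DProd (Ga G s) t (t + N)) r := by
    refine exists_isCRoot_of_rooted (ga_refl G s) hT fun t ht => ?_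
    obtain ⟨r, hr⟩ := hrooted t (by omega)
    exact ⟨r, fun v => Relation.ReflTransGen.mono (fun a b hab =>
      (dprod_congr (fun k hk => hactive k (ht.trans hk)) a b).2 hab) _ _ (hr v)⟩
  have hcentral : ∀ᶠ t in Filter.atTop, ∀ r, IsCRoot (DProd (Ga G s) t (t + N)) r →
      mStarMax G s μ ≤ mStar G s μ r := by
    rw [Filter.eventually_all]
    intro r
    by_cases hr : ∃ᶠ t in Filter.atTop, IsCRoot (DProd (Ga G s) t (t + N)) r
    · exact Filter.Eventually.of_forall fun _ _ => Finset.sup'_le _ _ fun u _ =>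
        mStar_le_of_frequently μ (hr.mono fun t ht => ⟨t + N, by omega, ht u⟩)
    · filter_upwards [Filter.not_frequently.1 hr] with t ht h using absurd h ht
  constructor
  · have hstable : ∀ᶠ t in Filter.atTop, ∀ u, yVal G s μ θ u t = mStarMax G s μ := by
      rw [Filter.eventually_all]
      intro u
      filter_upwards [(hsafe u).1.eventually (eventually_mVal_eq_mStar G s μ),
        ((Filter.tendsto_add_atTop_nat 1).comp (hsafe u).1).eventually hcentral,
        (hsafe u).1.eventually_ge_atTop (Finset.univ.sup s),
        (hsafe u).2.eventually_ge_atTop (N + 1)] with t hm hc hstart hlen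
      apply le_antisymm
      · refine Finset.sup'_le _ _ fun v _ => ?_
        rw [hm v]
        exact Finset.le_sup' (mStar G s μ) (Finset.mem_univ v)
      · obtain ⟨r, hr⟩ := hN (θ u t + 1) (by omega)
        refine (hc r hr).trans ((hm r).symm.le.trans ?_)
        exact Finset.le_sup' (fun v => mVal G s μ v (θ u t)) (Finset.mem_filter.2
          ⟨Finset.mem_univ r, (hr u).mono_right (ga_refl G s) (by omega) (by omega)⟩)
    obtain ⟨s', hs'⟩ := Filter.eventually_atTop.1 hstable
    exact ⟨s', fun u t ht => hs' t ht u⟩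
  · obtain ⟨u, -, hu⟩ := Finset.exists_mem_eq_sup' Finset.univ_nonempty (mStar G s μ)
    obtain ⟨w, -, hw⟩ := Finset.exists_mem_eq_inf' (s := Finset.univ.filter fun v =>
      ∃ t', 1 ≤ t' ∧ DProd (Ga G s) 1 t' v u) ⟨u, Finset.mem_filter.mpr ⟨Finset.mem_univ u,
      ⟨1, le_refl 1, dprod_refl (Ga G s) (ga_refl G s) 1 1 u⟩⟩⟩ μ
    exact ⟨w, hu.trans hw⟩
end

section
/- Let G be a dynamic graph over a finite nonempty set V with a self-loop at every node in every round, with start rounds s_u and input values μ_u in a finite linearly ordered set 𝒱, and let x_u(t) and AGE_u(t) be defined by the AGE recursion. If node u is active at round t (i.e., t ≥ s_u), then for every value ν ∈ 𝒱 and every integer k with 0 ≤ k ≤ t: AGE_u(t)[ν] ≤ k if and only if there exists a node v ∈ In^a_u(t−k+1 : t) with x_v(t−k) = ν. -/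
open scoped Classical

section Age

variable {V 𝒱 : Type*} [Fintype V] [Fintype 𝒱] [LinearOrder 𝒱]

/-- The AGE recursion, computing for each round `t` and node `u` the pair
`(x_u(t), AGE_u(t))`. -/
noncomputable def AgeX (G : ℕ → V → V → Prop) (s : V → ℕ) (μ : V → 𝒱) :
    ℕ → V → 𝒱 × (𝒱 → ℕ∞)
  | 0 => fun u => (μ u, fun ν => if ν = μ u then 0 else ⊤)
  | t + 1 => fun u =>
      if s u ≤ t + 1 then
        let A : 𝒱 → ℕ∞ := fun ν =>
          1 + (Finset.univ.filter fun v => Ga G s (t + 1) v u).inf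
            (fun v => (AgeX G s μ t v).2 ν)
        let x : 𝒱 :=
          if h : (Finset.univ.filter fun ν => A ν < ⊤).Nonempty then
            (Finset.univ.filter fun ν => A ν < ⊤).min' h
          else μ u
        (x, fun ν => if ν = x then 0 else A ν)
      else (μ u, fun ν => if ν = μ u then 0 else ⊤)

end Age

section DynamicGraphs

variable {V : Type*}

/-- Splitting off the last round of a product of digraphs. -/
lemma dprod_succ_iff (H : ℕ → V → V → Prop) {a t : ℕ} (hat : a ≤ t + 1) (v u : V) :
    DProd H a (t + 1) v u ↔ ∃ w, DProd H a t v w ∧ H (t + 1) w u := by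
  unfold DProd
  rw [if_neg (by omega)]
  by_cases h : t < a
  · obtain rfl : a = t + 1 := by omega
    simp only [if_pos h]
    constructor
    · rintro ⟨w, rfl, rfl, hw⟩
      exact ⟨_, rfl, hw _ le_rfl le_rfl⟩
    · rintro ⟨_, rfl, hvu⟩
      refine ⟨fun i => if i = t + 1 then v else u, by simp, by simp, fun k hk hk' => ?_⟩
      obtain rfl : k = t + 1 := by omega
      simpa using hvu
  · simp only [if_neg h]
    constructor
    · rintro ⟨w, rfl, rfl, hw⟩
      exact ⟨w (t + 1), ⟨w, rfl, rfl, fun k hk hk' => hw k hk (by omega)⟩, hw _ hat le_rfl⟩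
    · rintro ⟨_, ⟨w, rfl, rfl, hw⟩, hu⟩
      refine ⟨fun i => if i = t + 2 then u else w i, ?_, by simp, fun k hk hk' => ?_⟩
      · simp [show a ≠ t + 2 by omega]
      · rcases hk'.eq_or_lt with rfl | hlt
        · simpa using hu
        · simpa [show k ≠ t + 2 by omega, show k ≠ t + 1 by omega] using hw k hk (by omega)

/-- A node that is inactive in round `t` hears only from itself in that round. -/
lemma ga_iff_eq_of_lt (G : ℕ → V → V → Prop) (s : V → ℕ) {t : ℕ} {u : V} (hu : t < s u) (v : V) :
    Ga G s t v u ↔ v = u := by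
  unfold Ga
  exact or_iff_left fun h => absurd h.2.2 (not_le.mpr hu)

end DynamicGraphs

section Age

variable {V 𝒱 : Type*} [Fintype V] [Fintype 𝒱] [LinearOrder 𝒱]
  (G : ℕ → V → V → Prop) (s : V → ℕ) (μ : V → 𝒱)

/-- The age of `ν` that `u` computes in round `t + 1`, before resetting the age of its output. -/
noncomputable def candidateAge (t : ℕ) (u : V) (ν : 𝒱) : ℕ∞ :=
  1 + (Finset.univ.filter fun v => Ga G s (t + 1) v u).inf (fun v => (AgeX G s μ t v).2 ν)

lemma ageX_of_lt {t : ℕ} {u : V} (hu : t < s u) :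
    AgeX G s μ t u = (μ u, fun ν => if ν = μ u then 0 else ⊤) := by
  cases t with
  | zero => rfl
  | succ t => exact if_neg (not_le.mpr hu)

lemma ageX_snd_succ {t : ℕ} {u : V} (hu : s u ≤ t + 1) (ν : 𝒱) :
    (AgeX G s μ (t + 1) u).2 ν =
      if ν = (AgeX G s μ (t + 1) u).1 then 0 else candidateAge G s μ t u ν := by
  simp only [AgeX, if_pos hu]
  rfl

lemma ageX_snd_fst (t : ℕ) (u : V) : (AgeX G s μ t u).2 (AgeX G s μ t u).1 = 0 := by
  rcases lt_or_ge t (s u) with hu | hu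
  · simp [ageX_of_lt G s μ hu]
  · cases t with
    | zero => simp [AgeX]
    | succ t => rw [ageX_snd_succ G s μ hu, if_pos rfl]

lemma candidateAge_le_iff (t : ℕ) (u : V) (ν : 𝒱) (k : ℕ) :
    candidateAge G s μ t u ν ≤ ((k + 1 : ℕ) : ℕ∞) ↔
      ∃ v, Ga G s (t + 1) v u ∧ (AgeX G s μ t v).2 ν ≤ (k : ℕ∞) := by
  unfold candidateAge
  rw [add_comm, Nat.cast_add, Nat.cast_one, ENat.add_le_add_iff_right ENat.one_ne_top,
    Finset.inf_le_iff (ENat.natCast_lt_top k)]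
  simp

lemma candidateAge_lt_top_iff (t : ℕ) (u : V) (ν : 𝒱) :
    candidateAge G s μ t u ν < ⊤ ↔
      ∃ v, Ga G s (t + 1) v u ∧ (AgeX G s μ t v).2 ν < ⊤ := by
  unfold candidateAge
  rw [ENat.add_lt_top, Finset.inf_lt_iff]
  simp

lemma isLeast_ageX_fst_succ {t : ℕ} {u : V} (hu : s u ≤ t + 1) :
    IsLeast {ν | candidateAge G s μ t u ν < ⊤} (AgeX G s μ (t + 1) u).1 := by
  have hne : (Finset.univ.filter fun ν => candidateAge G s μ t u ν < ⊤).Nonempty := by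
    refine ⟨(AgeX G s μ t u).1, ?_⟩
    rw [Finset.mem_filter, candidateAge_lt_top_iff]
    exact ⟨Finset.mem_univ _, u, ga_refl G s _ u, by simp [ageX_snd_fst]⟩
  have hx : (AgeX G s μ (t + 1) u).1 = Finset.min' _ hne := by
    simp only [AgeX, if_pos hu]
    exact dif_pos hne
  rw [hx]
  simpa using Finset.isLeast_min' _ hne

/-- The output of a node is the least value of finite age. -/
lemma ageX_fst_le {t : ℕ} {u : V} {ν : 𝒱} (h : (AgeX G s μ t u).2 ν < ⊤) :
    (AgeX G s μ t u).1 ≤ ν := by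
  by_contra hlt
  have hne : ν ≠ (AgeX G s μ t u).1 := fun e => hlt e.ge
  rcases lt_or_ge t (s u) with hu | hu
  · rw [ageX_of_lt G s μ hu] at h hne
    simp [hne] at h
  · cases t with
    | zero => simp_all [AgeX]
    | succ t =>
      rw [ageX_snd_succ G s μ hu, if_neg hne] at h
      exact hlt ((isLeast_ageX_fst_succ G s μ hu).2 h)

lemma candidateAge_fst_le_one {t : ℕ} {u : V} (hu : s u ≤ t + 1) :
    candidateAge G s μ t u (AgeX G s μ (t + 1) u).1 ≤ 1 := by
  obtain ⟨hmem, hle⟩ := isLeast_ageX_fst_succ G s μ hu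
  obtain ⟨v, hv, hfin⟩ := (candidateAge_lt_top_iff G s μ t u _).1 hmem
  have hx : (AgeX G s μ t v).1 = (AgeX G s μ (t + 1) u).1 :=
    le_antisymm (ageX_fst_le G s μ hfin) <| hle <|
      (candidateAge_lt_top_iff G s μ t u _).2 ⟨v, hv, by simp [ageX_snd_fst]⟩
  have h := (candidateAge_le_iff G s μ t u (AgeX G s μ (t + 1) u).1 0).2
    ⟨v, hv, by rw [← hx, ageX_snd_fst]; simp⟩
  simpa using h

lemma ageX_snd_eq_zero_iff (t : ℕ) (u : V) (ν : 𝒱) :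
    (AgeX G s μ t u).2 ν = 0 ↔ (AgeX G s μ t u).1 = ν := by
  refine ⟨fun h => ?_, fun h => h ▸ ageX_snd_fst G s μ t u⟩
  by_contra hne
  rcases lt_or_ge t (s u) with hu | hu
  · rw [ageX_of_lt G s μ hu] at h hne
    simp [Ne.symm hne] at h
  · cases t with
    | zero => simp_all [AgeX]
    | succ t =>
      rw [ageX_snd_succ G s μ hu, if_neg (Ne.symm hne)] at h
      simp [candidateAge] at h

/-- One round of the AGE recursion, for active and inactive nodes alike. -/
lemma ageX_snd_succ_le_iff (t : ℕ) (u : V) (ν : 𝒱) (k : ℕ) :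
    (AgeX G s μ (t + 1) u).2 ν ≤ ((k + 1 : ℕ) : ℕ∞) ↔
      ∃ v, Ga G s (t + 1) v u ∧ (AgeX G s μ t v).2 ν ≤ (k : ℕ∞) := by
  rcases lt_or_ge (t + 1) (s u) with hu | hu
  · simp only [ga_iff_eq_of_lt G s hu, exists_eq_left, ageX_of_lt G s μ hu,
      ageX_of_lt G s μ (t.lt_succ_self.trans hu)]
    split_ifs <;> simp [-Nat.cast_add]
  · rw [← candidateAge_le_iff, ageX_snd_succ G s μ hu]
    split_ifs with h
    · subst h
      have h1 : (1 : ℕ∞) ≤ ((k + 1 : ℕ) : ℕ∞) := by exact_mod_cast Nat.le_add_left 1 k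
      simp only [zero_le, (candidateAge_fst_le_one G s μ hu).trans h1]
    · rfl

/-- The characterization of ages in `ageX_le_iff`, without assuming that `u` is active. -/
lemma ageX_snd_le_iff (ν : 𝒱) (k : ℕ) : ∀ (t : ℕ) (u : V), k ≤ t →
    ((AgeX G s μ t u).2 ν ≤ (k : ℕ∞) ↔
      ∃ v : V, DProd (Ga G s) (t - k + 1) t v u ∧ (AgeX G s μ (t - k) v).1 = ν) := by
  induction k with
  | zero => simp [DProd, ageX_snd_eq_zero_iff]
  | succ k ih =>
    rintro (_ | t) u hk
    · omega
    · simp only [ageX_snd_succ_le_iff, Nat.add_sub_add_right,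
        dprod_succ_iff _ (show t - k + 1 ≤ t + 1 by omega), ih t _ (Nat.le_of_succ_le_succ hk)]
      tauto

end Age

/-- if `u` is active at round `t`, then for every value `ν` and every
`k ≤ t`: `AGE_u(t)[ν] ≤ k` iff some `v ∈ In^a_u(t−k+1 : t)` has `x_v(t−k) = ν`. -/
theorem ageX_le_iff {V 𝒱 : Type*} [Fintype V] [Nonempty V] [Fintype 𝒱] [LinearOrder 𝒱]
    (G : ℕ → V → V → Prop) (hloop : ∀ t u, G t u u)
    (s : V → ℕ) (hs : ∀ u, 1 ≤ s u) (μ : V → 𝒱)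
    (u : V) (t : ℕ) (hu : s u ≤ t) :
    ∀ (ν : 𝒱) (k : ℕ), k ≤ t →
      ((AgeX G s μ t u).2 ν ≤ (k : ℕ∞) ↔
        ∃ v : V, DProd (Ga G s) (t - k + 1) t v u ∧ (AgeX G s μ (t - k) v).1 = ν) := by
  intro ν k hk
  exact ageX_snd_le_iff G s μ ν k t u hk
end

section
/- Let G be a dynamic graph over a finite nonempty set V, with a self-loop at every node in every round. Then there exists a round s ≥ 1 such that for every t ≥ s, every root of the digraph G(t) belongs to Ker(G): Roots(G(t)) ⊆ Ker(G) for all t ≥ s. -/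
open scoped Classical

theorem DProd.snoc {V : Type*} {G : ℕ → V → V → Prop} {t t' : ℕ} {u v w : V}
    (ht : t ≤ t') (h : DProd G t t' u v) (e : G (t' + 1) v w) : DProd G t (t' + 1) u w := by
  rw [DProd, if_neg (by omega)] at h ⊢
  obtain ⟨p, hpu, hpv, hp⟩ := h
  refine ⟨Function.update p (t' + 2) w, ?_, by simp, fun k hk hk' => ?_⟩
  · rw [Function.update_of_ne (by omega), hpu]
  · rw [Function.update_of_ne (by omega)]
    rcases hk'.eq_or_lt with rfl | hlt
    · simpa [hpv] using e
    · rw [Function.update_of_ne (by omega)]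
      exact hp k hk (by omega)

theorem DProd.mono_right_s19 {V : Type*} {G : ℕ → V → V → Prop} (hloop : ∀ t u, G t u u)
    {t t₁ t₂ : ℕ} {u v : V} (ht : t ≤ t₁) (h₁₂ : t₁ ≤ t₂) (h : DProd G t t₁ u v) :
    DProd G t t₂ u v := by
  induction t₂, h₁₂ using Nat.le_induction with
  | base => exact h
  | succ n hn ih => exact ih.snoc (ht.trans hn) (hloop _ _)

/-- The out-neighbours in the integral at round `t` are all reached by some common round. -/
theorem exists_dprod_of_integral {V : Type*} [Finite V] {G : ℕ → V → V → Prop}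
    (hloop : ∀ t u, G t u u) (t : ℕ) (u : V) :
    ∃ K, t ≤ K ∧ ∀ v, Integral G t u v → DProd G t K u v := by
  have h : ∀ᶠ K in Filter.atTop, ∀ v, Integral G t u v → DProd G t K u v := by
    refine Filter.eventually_all.2 fun v => ?_
    by_cases hv : Integral G t u v
    · obtain ⟨K, hK, hd⟩ := hv
      filter_upwards [Filter.eventually_ge_atTop K] with n hn _
      exact hd.mono_right_s19 hloop hK hn
    · exact .of_forall fun _ h => absurd h hv
  exact ((Filter.eventually_ge_atTop t).and h).exists

/-- A node that is a root infinitely often belongs to the kernel. -/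
theorem mem_ker_of_frequently_isRoot_s19 {V : Type*} [Finite V] {G : ℕ → V → V → Prop}
    (hloop : ∀ t u, G t u u) {u : V} (h : ∃ᶠ t in Filter.atTop, IsRoot (G t) u) :
    u ∈ Ker G := by
  intro t _ v
  obtain ⟨K, hK, hd⟩ := exists_dprod_of_integral hloop t u
  obtain ⟨k, hk, hroot⟩ := Filter.frequently_atTop.1 h (K + 1)
  obtain ⟨n, rfl⟩ : ∃ n, k = n + 1 := ⟨k - 1, by omega⟩
  induction hroot v with
  | refl => exact ⟨t, le_rfl, dprod_refl G hloop t t u⟩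
  | tail _ e ih =>
    exact ⟨n + 1, by omega, ((hd _ ih).mono_right_s19 hloop hK (by omega)).snoc (by omega) e⟩

/-- eventually all roots of `G(t)` belong to the kernel of `G`. -/
theorem roots_eventually_in_kernel {V : Type*} [Fintype V] [Nonempty V]
    (G : ℕ → V → V → Prop) (hloop : ∀ t u, G t u u) :
    ∃ s : ℕ, 1 ≤ s ∧ ∀ t, s ≤ t → ∀ u : V, IsRoot (G t) u → u ∈ Ker G := by
  have h : ∀ᶠ t in Filter.atTop, ∀ u : V, IsRoot (G t) u → u ∈ Ker G := by
    refine Filter.eventually_all.2 fun u => ?_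
    by_cases hu : ∃ᶠ t in Filter.atTop, IsRoot (G t) u
    · exact .of_forall fun _ _ => mem_ker_of_frequently_isRoot_s19 hloop hu
    · filter_upwards [Filter.not_frequently.1 hu] with t ht h
      exact absurd h ht
  obtain ⟨s, hs⟩ := Filter.eventually_atTop.1 h
  exact ⟨s + 1, by omega, fun t ht => hs t (by omega)⟩
end
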